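/- arXiv:1809.02041 — 3 statements merged into one kernel-verified Lean document; each statement's English description precedes it below -/
import Mathlib

section
/- Main theorem: every flow embeds equivariantly into the translation flow on L(ℝ)^ℕ. Precisely, let X be a compact metric space and let φ : ℝ × X → X be a continuous ℝ-action (φ_0 = id and φ_{s+t} = φ_s ∘ φ_t). Then there exists a topological embedding Φ : X → L(ℝ)^ℕ (a homeomorphism of X onto its image, where L(ℝ)^ℕ carries the product of the compact-open topologies) such that for all x ∈ X, r ∈ ℝ, n ∈ ℕ and t ∈ ℝ, one has Φ(φ_r(x))(n)(t) = Φ(x)(n)(t + r). -/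
/-- `L(ℝ)`: the set of `1`-Lipschitz functions `ℝ → [0,1]`, as a subspace of `C(ℝ, ℝ)`
with the compact-open topology (uniform convergence on compact subsets). -/
abbrev LR : Type := {f : C(ℝ, ℝ) // LipschitzWith 1 f ∧ ∀ t : ℝ, f t ∈ Set.Icc (0 : ℝ) 1}

theorem lipschitzWith_one_slidingIntegral {k : ℝ → ℝ} (hk : Continuous k)
    (hk01 : ∀ s, k s ∈ Set.Icc (0 : ℝ) 1) (a : ℝ) :
    LipschitzWith 1 fun t : ℝ => ∫ s in 0..a, k (s + t) := by
  refine LipschitzWith.of_dist_le_mul fun t u => ?_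
  have hi : ∀ b c : ℝ, IntervalIntegrable k MeasureTheory.volume b c :=
    fun b c => hk.intervalIntegrable b c
  have key : (∫ s in 0..a, k (s + t)) - ∫ s in 0..a, k (s + u)
      = ∫ s in t..u, (k s - k (s + a)) := by
    rw [intervalIntegral.integral_sub (hi _ _)
      (Continuous.intervalIntegrable (by fun_prop) _ _)]
    simp only [intervalIntegral.integral_comp_add_right]
    rw [intervalIntegral.integral_interval_sub_interval_comm (hi _ _) (hi _ _) (hi _ _)]
    simp only [zero_add, add_comm a]
  rw [Real.dist_eq, key, NNReal.coe_one, dist_comm, Real.dist_eq, ← Real.norm_eq_abs]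
  refine intervalIntegral.norm_integral_le_of_norm_le_const fun s _ => ?_
  obtain ⟨h1, h2⟩ := hk01 s
  obtain ⟨h3, h4⟩ := hk01 (s + a)
  rw [Real.norm_eq_abs, abs_le]
  constructor <;> linarith

theorem intervalIntegral_mem_Icc_zero_one {k : ℝ → ℝ} (hk : Continuous k)
    (hk01 : ∀ s, k s ∈ Set.Icc (0 : ℝ) 1) {a : ℝ} (ha : a ∈ Set.Icc (0 : ℝ) 1) :
    ∫ s in 0..a, k s ∈ Set.Icc (0 : ℝ) 1 := by
  refine ⟨intervalIntegral.integral_nonneg ha.1 fun s _ => (hk01 s).1, ?_⟩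
  calc ∫ s in 0..a, k s ≤ ∫ _ in 0..a, (1 : ℝ) :=
        intervalIntegral.integral_mono_on ha.1 (hk.intervalIntegrable _ _)
          (continuous_const.intervalIntegrable _ _) fun s _ => (hk01 s).2
    _ ≤ 1 := by simpa using ha.2

theorem eq_at_zero_of_intervalIntegral_eq {k l : ℝ → ℝ} (hk : Continuous k) (hl : Continuous l)
    (h : ∀ m : ℕ, ∫ s in 0..(1 / ((m : ℝ) + 1)), k s = ∫ s in 0..(1 / ((m : ℝ) + 1)), l s) :
    k 0 = l 0 := by
  have hseq : Filter.Tendsto (fun m : ℕ => 1 / ((m : ℝ) + 1)) Filter.atTop (nhdsWithin 0 {0}ᶜ) :=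
    tendsto_nhdsWithin_iff.2 ⟨tendsto_one_div_add_atTop_nhds_zero_nat,
      Filter.Eventually.of_forall fun m => (Nat.one_div_pos_of_nat (n := m)).ne'⟩
  have lim : ∀ {f : ℝ → ℝ}, Continuous f → Filter.Tendsto
      (fun m : ℕ => slope (fun b => ∫ s in 0..b, f s) 0 (1 / ((m : ℝ) + 1)))
      Filter.atTop (nhds (f 0)) := fun hf =>
    (hasDerivAt_iff_tendsto_slope.1 (hf.integral_hasStrictDerivAt 0 0).hasDerivAt).comp hseq
  refine tendsto_nhds_unique (lim hk) ((lim hl).congr fun m => ?_)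
  simp only [slope_def_field, h m, intervalIntegral.integral_same]

/-- The `LR`-valued map sending `x` to the integrals of `g` along the orbit segments of length `a`
starting at the points `φ t x`. -/
noncomputable def orbitIntegral {X : Type*} [TopologicalSpace X] (φ : ℝ → X → X)
    (hcont : Continuous fun p : ℝ × X => φ p.1 p.2) (g : X → ℝ) (hg : Continuous g)
    (hg01 : ∀ x, g x ∈ Set.Icc (0 : ℝ) 1) (a : ℝ) (ha : a ∈ Set.Icc (0 : ℝ) 1) (x : X) : LR :=
  have hk : Continuous fun s => g (φ s x) :=
    hg.comp (hcont.comp (continuous_id.prodMk continuous_const))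
  ⟨⟨fun t => ∫ s in 0..a, g (φ (s + t) x),
      (lipschitzWith_one_slidingIntegral hk (fun _ => hg01 _) a).continuous⟩,
    lipschitzWith_one_slidingIntegral hk (fun _ => hg01 _) a,
    fun t => intervalIntegral_mem_Icc_zero_one (k := fun s => g (φ (s + t) x))
      (hk.comp (continuous_id.add continuous_const)) (fun _ => hg01 _) ha⟩

theorem continuous_orbitIntegral {X : Type*} [TopologicalSpace X] (φ : ℝ → X → X)
    (hcont : Continuous fun p : ℝ × X => φ p.1 p.2) (g : X → ℝ) (hg : Continuous g)
    (hg01 : ∀ x, g x ∈ Set.Icc (0 : ℝ) 1) (a : ℝ) (ha : a ∈ Set.Icc (0 : ℝ) 1) :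
    Continuous (orbitIntegral φ hcont g hg hg01 a ha) := by
  refine Continuous.subtype_mk (ContinuousMap.continuous_of_continuous_uncurry _ ?_) _
  change Continuous fun p : X × ℝ => ∫ s in 0..a, g (φ (s + p.2) p.1)
  refine intervalIntegral.continuous_parametric_intervalIntegral_of_continuous' ?_ 0 a
  exact hg.comp (hcont.comp (f := fun q : (X × ℝ) × ℝ => (q.2 + q.1.2, q.1.1)) (by fun_prop))

/-- Main theorem: every flow `(X, φ)` on a compact metric space embeds
equivariantly into the translation flow on `L(ℝ)^ℕ` (with the product topology). -/
theorem flow_embeds_in_LR_pow (X : Type*) [MetricSpace X] [CompactSpace X]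
    (φ : ℝ → X → X) (hcont : Continuous fun p : ℝ × X => φ p.1 p.2)
    (h0 : ∀ x : X, φ 0 x = x) (hadd : ∀ (s t : ℝ) (x : X), φ (s + t) x = φ s (φ t x)) :
    ∃ Φ : X → ℕ → LR,
      Topology.IsEmbedding Φ ∧
      ∀ (x : X) (r : ℝ) (n : ℕ) (t : ℝ),
        ((Φ (φ r x) n : C(ℝ, ℝ)) t) = (Φ x n : C(ℝ, ℝ)) (t + r) := by
  rcases isEmpty_or_nonempty X with hX | hX
  · exact ⟨fun x => isEmptyElim x, .of_subsingleton _, fun x => isEmptyElim x⟩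
  let g : ℕ → X → ℝ := fun n x => min 1 (dist x (TopologicalSpace.denseSeq X n))
  have hg : ∀ n, Continuous (g n) := fun n => by fun_prop
  have hg01 : ∀ n x, g n x ∈ Set.Icc (0 : ℝ) 1 :=
    fun n x => ⟨le_min zero_le_one dist_nonneg, min_le_left _ _⟩
  have ha : ∀ m : ℕ, 1 / ((m : ℝ) + 1) ∈ Set.Icc (0 : ℝ) 1 := fun m =>
    ⟨by positivity, div_le_one_of_le₀ (by linarith [m.cast_nonneg (α := ℝ)]) (by positivity)⟩
  let Φ : X → ℕ → LR := fun x n =>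
    orbitIntegral φ hcont (g n.unpair.1) (hg _) (hg01 _) (1 / ((n.unpair.2 : ℝ) + 1)) (ha _) x
  have hΦ : Continuous Φ := continuous_pi fun n => continuous_orbitIntegral _ _ _ _ _ _ _
  have hinj : Function.Injective Φ := by
    intro x y hxy
    have hgxy : ∀ n, g n x = g n y := by
      intro n
      have horb : ∀ z, Continuous fun s => g n (φ s z) := fun z =>
        (hg n).comp (hcont.comp (continuous_id.prodMk continuous_const))
      have := eq_at_zero_of_intervalIntegral_eq (horb x) (horb y) fun m => by
        have h := congrArg (fun F : ℕ → LR => (F (Nat.pair n m) : C(ℝ, ℝ)) 0) hxy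
        simpa [Φ, orbitIntegral] using h
      simpa only [h0] using this
    refine eq_of_forall_dist_le fun ε hε => ?_
    obtain ⟨n, hn⟩ := (TopologicalSpace.denseRange_denseSeq X).exists_dist_lt x
      (ε := min 1 (ε / 2)) (by positivity)
    obtain ⟨hn1, hn2⟩ := lt_min_iff.1 hn
    have hy : min 1 (dist y (TopologicalSpace.denseSeq X n))
        = dist x (TopologicalSpace.denseSeq X n) :=
      (hgxy n).symm.trans (min_eq_right hn1.le)
    have hy' : dist y (TopologicalSpace.denseSeq X n) < ε / 2 := by
      rcases min_choice 1 (dist y (TopologicalSpace.denseSeq X n)) with h | h <;> linarith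
    linarith [dist_triangle_right x y (TopologicalSpace.denseSeq X n)]
  refine ⟨Φ, (hΦ.isClosedEmbedding hinj).isEmbedding, fun x r n t => ?_⟩
  change ∫ s in 0..(1 / ((n.unpair.2 : ℝ) + 1)), g n.unpair.1 (φ (s + t) (φ r x))
    = ∫ s in 0..(1 / ((n.unpair.2 : ℝ) + 1)), g n.unpair.1 (φ (s + (t + r)) x)
  simp only [← hadd, add_assoc]
end

section
/- Strengthened main theorem: every flow embeds equivariantly into the translation on L(ℝ)^ℕ in such a way that every coordinate function of every point of the image is continuously differentiable. Precisely, let X be a compact metric space with a continuous ℝ-action φ : ℝ × X → X (φ_0 = id, φ_{s+t} = φ_s ∘ φ_t). Then there exists a topological embedding Φ : X → L(ℝ)^ℕ such that Φ(φ_r(x))(n)(t) = Φ(x)(n)(t + r) for all x ∈ X, r ∈ ℝ, n ∈ ℕ, t ∈ ℝ, and such that for every x ∈ X and n ∈ ℕ the function Φ(x)(n) : ℝ → ℝ is of class C¹. -/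
/-- The integral `t ↦ ∫ s in t..t+h, u s` over a moving window, written with a fixed interval of
integration. -/
noncomputable def movingIntegral (u : ℝ → ℝ) (h t : ℝ) : ℝ := ∫ s in (0 : ℝ)..h, u (s + t)

theorem hasDerivAt_movingIntegral {u : ℝ → ℝ} (hu : Continuous u) (h t : ℝ) :
    HasDerivAt (movingIntegral u h) (u (t + h) - u t) t := by
  have hprim (a : ℝ) : HasDerivAt (fun b => ∫ s in (0 : ℝ)..b, u s) (u a) a :=
    intervalIntegral.integral_hasDerivAt_right (hu.intervalIntegrable _ _)
      hu.aestronglyMeasurable.stronglyMeasurableAtFilter hu.continuousAt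
  have heq : movingIntegral u h =
      fun t => (∫ s in (0 : ℝ)..(t + h), u s) - ∫ s in (0 : ℝ)..t, u s := by
    funext t
    rw [movingIntegral, intervalIntegral.integral_comp_add_right,
      intervalIntegral.integral_interval_sub_left (hu.intervalIntegrable _ _)
        (hu.intervalIntegrable _ _), zero_add, add_comm]
  rw [heq]
  exact ((hprim (t + h)).comp_add_const t h).sub (hprim t)

theorem contDiff_movingIntegral {u : ℝ → ℝ} (hu : Continuous u) (h : ℝ) :
    ContDiff ℝ 1 (movingIntegral u h) := by
  refine contDiff_one_iff_deriv.2 ⟨fun t => (hasDerivAt_movingIntegral hu h t).differentiableAt, ?_⟩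
  rw [funext fun t => (hasDerivAt_movingIntegral hu h t).deriv]
  fun_prop

theorem lipschitzWith_movingIntegral {u : ℝ → ℝ} (hu : Continuous u)
    (hu01 : ∀ t, u t ∈ Set.Icc (0 : ℝ) 1) (h : ℝ) : LipschitzWith 1 (movingIntegral u h) := by
  refine lipschitzWith_of_nnnorm_deriv_le
    (fun t => (hasDerivAt_movingIntegral hu h t).differentiableAt) fun t => ?_
  rw [(hasDerivAt_movingIntegral hu h t).deriv, ← NNReal.coe_le_coe, coe_nnnorm, Real.norm_eq_abs,
    NNReal.coe_one, abs_le]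
  have h₁ := hu01 (t + h)
  have h₂ := hu01 t
  constructor <;> linarith [h₁.1, h₁.2, h₂.1, h₂.2]

theorem movingIntegral_mem_Icc {u : ℝ → ℝ} (hu : Continuous u)
    (hu01 : ∀ t, u t ∈ Set.Icc (0 : ℝ) 1) {h : ℝ} (hh : h ∈ Set.Icc (0 : ℝ) 1) (t : ℝ) :
    movingIntegral u h t ∈ Set.Icc (0 : ℝ) 1 := by
  refine ⟨intervalIntegral.integral_nonneg hh.1 fun s _ => (hu01 _).1, ?_⟩
  have hint : IntervalIntegrable (fun s => u (s + t)) MeasureTheory.volume 0 h :=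
    Continuous.intervalIntegrable (by fun_prop) _ _
  calc movingIntegral u h t ≤ ∫ _ in (0 : ℝ)..h, (1 : ℝ) :=
        intervalIntegral.integral_mono_on hh.1 hint intervalIntegrable_const
          fun s _ => (hu01 _).2
    _ ≤ 1 := by simpa using hh.2

/-- A continuous function is determined at `0` by its integrals over `[0, 1 / (m + 1)]`. -/
theorem eq_of_forall_movingIntegral_eq {u v : ℝ → ℝ} (hu : Continuous u) (hv : Continuous v)
    (huv : ∀ m : ℕ, movingIntegral u (1 / ((m : ℝ) + 1)) 0 =
      movingIntegral v (1 / ((m : ℝ) + 1)) 0) : u 0 = v 0 := by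
  have hlim {w : ℝ → ℝ} (hw : Continuous w) : Filter.Tendsto
      (fun m : ℕ => (1 / ((m : ℝ) + 1))⁻¹ * movingIntegral w (1 / ((m : ℝ) + 1)) 0)
      Filter.atTop (nhds (w 0)) := by
    have hd : HasDerivAt (fun b => ∫ s in (0 : ℝ)..b, w s) (w 0) 0 :=
      intervalIntegral.integral_hasDerivAt_right (hw.intervalIntegrable _ _)
        hw.aestronglyMeasurable.stronglyMeasurableAtFilter hw.continuousAt
    have hseq : Filter.Tendsto (fun m : ℕ => 1 / ((m : ℝ) + 1)) Filter.atTop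
        (nhdsWithin 0 {0}ᶜ) :=
      tendsto_nhdsWithin_iff.2 ⟨tendsto_one_div_add_atTop_nhds_zero_nat,
        Filter.Eventually.of_forall fun m => (Nat.one_div_pos_of_nat (n := m)).ne'⟩
    simpa [movingIntegral, Function.comp_def] using hd.tendsto_slope_zero.comp hseq
  refine tendsto_nhds_unique (hlim hu) ?_
  simpa only [huv] using hlim hv

/-- The distances to a dense sequence, truncated at `1`, separate points. -/
theorem eq_of_forall_min_dist_denseSeq_eq {X : Type*} [MetricSpace X]
    [TopologicalSpace.SeparableSpace X] [Nonempty X] {x y : X}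
    (hxy : ∀ k, min 1 (dist x (TopologicalSpace.denseSeq X k)) =
      min 1 (dist y (TopologicalSpace.denseSeq X k))) : x = y := by
  have hfun : (fun z => min 1 (dist x z)) = fun z => min 1 (dist y z) :=
    Continuous.ext_on (TopologicalSpace.denseRange_denseSeq X) (by fun_prop) (by fun_prop)
      (Set.forall_mem_range.2 hxy)
  have h := congrFun hfun y
  simp only [dist_self, zero_le_one, min_eq_right] at h
  rcases min_choice 1 (dist x y) with h' | h'
  · linarith
  · exact dist_eq_zero.1 (h'.symm.trans h)

/-- Strengthened main theorem: every flow on a compact metric space embeds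
equivariantly into the translation on `L(ℝ)^ℕ` so that every coordinate function of every
point of the image is continuously differentiable (of class `C¹`). -/
theorem flow_embeds_in_LR_pow_C1 (X : Type*) [MetricSpace X] [CompactSpace X]
    (φ : ℝ → X → X) (hcont : Continuous fun p : ℝ × X => φ p.1 p.2)
    (h0 : ∀ x : X, φ 0 x = x) (hadd : ∀ (s t : ℝ) (x : X), φ (s + t) x = φ s (φ t x)) :
    ∃ Φ : X → ℕ → LR,
      Topology.IsEmbedding Φ ∧
      (∀ (x : X) (r : ℝ) (n : ℕ) (t : ℝ),
        ((Φ (φ r x) n : C(ℝ, ℝ)) t) = (Φ x n : C(ℝ, ℝ)) (t + r)) ∧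
      (∀ (x : X) (n : ℕ), ContDiff ℝ 1 ((Φ x n : C(ℝ, ℝ)) : ℝ → ℝ)) := by
  cases isEmpty_or_nonempty X with
  | inl hX =>
    exact ⟨isEmptyElim, .of_subsingleton _, fun x => isEmptyElim x, fun x => isEmptyElim x⟩
  | inr hX =>
    let u (k : ℕ) (x : X) (t : ℝ) : ℝ := min 1 (dist (φ t x) (TopologicalSpace.denseSeq X k))
    have huc (k : ℕ) : Continuous fun p : X × ℝ => u k p.1 p.2 :=
      continuous_const.min ((hcont.comp continuous_swap).dist continuous_const)
    have hu (k : ℕ) (x : X) : Continuous (u k x) := (huc k).comp (Continuous.prodMk_right x)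
    have hu01 (k : ℕ) (x : X) (t : ℝ) : u k x t ∈ Set.Icc (0 : ℝ) 1 :=
      ⟨le_min zero_le_one dist_nonneg, min_le_left _ _⟩
    have hh (m : ℕ) : 1 / ((m : ℝ) + 1) ∈ Set.Icc (0 : ℝ) 1 :=
      ⟨Nat.one_div_pos_of_nat.le, by simpa using Nat.one_div_le_one_div (α := ℝ) m.zero_le⟩
    let Φ (x : X) (n : ℕ) : LR :=
      ⟨⟨movingIntegral (u n.unpair.1 x) (1 / ((n.unpair.2 : ℝ) + 1)),
          (contDiff_movingIntegral (hu _ x) _).continuous⟩,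
        lipschitzWith_movingIntegral (hu _ x) (hu01 _ x) _,
        movingIntegral_mem_Icc (hu _ x) (hu01 _ x) (hh _)⟩
    have hΦ : Continuous Φ := by
      refine continuous_pi fun n => Continuous.subtype_mk
        (ContinuousMap.continuous_of_continuous_uncurry _ ?_) _
      refine intervalIntegral.continuous_parametric_intervalIntegral_of_continuous'
        (f := fun (p : X × ℝ) s => u n.unpair.1 p.1 (s + p.2)) ?_ _ _
      exact (huc _).comp (by fun_prop : Continuous fun q : (X × ℝ) × ℝ => (q.1.1, q.2 + q.1.2))
    have hinj : Function.Injective Φ := by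
      refine fun x y hxy => eq_of_forall_min_dist_denseSeq_eq fun k => ?_
      have h : u k x 0 = u k y 0 := eq_of_forall_movingIntegral_eq (hu k x) (hu k y) fun m => by
        simpa [Φ] using congrArg (fun f : ℕ → LR => (f (Nat.pair k m)).1 0) hxy
      simpa only [u, h0] using h
    refine ⟨Φ, (hΦ.isClosedEmbedding hinj).isEmbedding, fun x r n t => ?_,
      fun x n => contDiff_movingIntegral (hu _ x) _⟩
    simp [Φ, movingIntegral, u, ← hadd, add_assoc]
end

section
/- For every positive integer n, every flow embeds equivariantly into the translation on L(ℝ)^ℕ in such a way that every coordinate function of every point of the image is n-times continuously differentiable. Precisely, let X be a compact metric space with a continuous ℝ-action φ : ℝ × X → X (φ_0 = id, φ_{s+t} = φ_s ∘ φ_t), and let n ≥ 1 be an integer. Then there exists a topological embedding Φ : X → L(ℝ)^ℕ such that Φ(φ_r(x))(k)(t) = Φ(x)(k)(t + r) for all x ∈ X, r ∈ ℝ, k ∈ ℕ, t ∈ ℝ, and such that for every x ∈ X and k ∈ ℕ the function Φ(x)(k) : ℝ → ℝ is of class Cⁿ. -/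
open MeasureTheory Filter Topology
open scoped Convolution

/-- A compact metric space carries a sequence of nonnegative continuous functions separating points. -/
lemma exists_nonneg_separating_seq (X : Type*) [MetricSpace X] [CompactSpace X] :
    ∃ f : ℕ → X → ℝ, (∀ k, Continuous (f k)) ∧ (∀ k x, 0 ≤ f k x) ∧
      ∀ x y, (∀ k, f k x = f k y) → x = y := by
  rcases isEmpty_or_nonempty X with hX | hX
  · exact ⟨fun _ _ => 0, fun _ => continuous_const, fun _ _ => le_rfl, fun x => hX.elim x⟩
  · refine ⟨fun k x => dist x (TopologicalSpace.denseSeq X k), fun k => by fun_prop,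
      fun _ _ => dist_nonneg, fun x y h => ?_⟩
    have key : (fun z => dist x z) = fun z => dist y z :=
      (TopologicalSpace.denseRange_denseSeq X).equalizer (by fun_prop) (by fun_prop) (funext h)
    exact dist_eq_zero.1 ((congrFun key y).trans (dist_self y))

section Mollify

variable {F : ℝ → ℝ} {B : ℝ}

/-- Convolving a bounded continuous function with a compactly supported continuous kernel gives a
bounded function. -/
lemma norm_convolution_le_of_bounded {g : ℝ → ℝ} (hg : Continuous g) (hgc : HasCompactSupport g)
    (hB : ∀ t, |F t| ≤ B) (t : ℝ) :
    |(g ⋆[ContinuousLinearMap.lsmul ℝ ℝ, volume] F) t| ≤ (∫ s, |g s|) * B := by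
  rw [convolution_def, ← Real.norm_eq_abs, ← integral_mul_const]
  refine norm_integral_le_of_norm_le
    ((hg.integrable_of_hasCompactSupport hgc).abs.mul_const B) (Eventually.of_forall fun s => ?_)
  simp only [ContinuousLinearMap.lsmul_apply, smul_eq_mul, norm_mul, Real.norm_eq_abs]
  exact mul_le_mul_of_nonneg_left (hB _) (abs_nonneg _)

/-- A scale factor making every mollification of functions bounded by `B` both `1`-Lipschitz and
`[0,1]`-valued. -/
lemma exists_scale_mollify (ρ : ContDiffBump (0 : ℝ)) (hB0 : 0 ≤ B) :
    ∃ c : ℝ, 0 < c ∧ ∀ F : ℝ → ℝ, Continuous F → (∀ t, 0 ≤ F t) → (∀ t, F t ≤ B) →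
      LipschitzWith 1
        (fun t => c * (ρ.normed volume ⋆[ContinuousLinearMap.lsmul ℝ ℝ, volume] F) t) ∧
      ∀ t, c * (ρ.normed volume ⋆[ContinuousLinearMap.lsmul ℝ ℝ, volume] F) t
        ∈ Set.Icc (0 : ℝ) 1 := by
  set g : ℝ → ℝ := ρ.normed volume with hg
  have hgs : ContDiff ℝ 1 g := ρ.contDiff_normed
  have hgc : HasCompactSupport g := ρ.hasCompactSupport_normed
  set I := ∫ s, |g s|
  set J := ∫ s, |deriv g s|
  have hI : 0 ≤ I := integral_nonneg fun s => abs_nonneg _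
  have hJ : 0 ≤ J := integral_nonneg fun s => abs_nonneg _
  have hD : 0 < 1 + I * B + J * B := by positivity
  refine ⟨(1 + I * B + J * B)⁻¹, inv_pos.2 hD, fun F hF hF0 hFB => ?_⟩
  have habs : ∀ t, |F t| ≤ B := fun t => by rw [abs_of_nonneg (hF0 t)]; exact hFB t
  have hderiv : ∀ t, HasDerivAt
      (fun t => (1 + I * B + J * B)⁻¹ * (g ⋆[ContinuousLinearMap.lsmul ℝ ℝ, volume] F) t)
      ((1 + I * B + J * B)⁻¹ *
        (deriv g ⋆[ContinuousLinearMap.lsmul ℝ ℝ, volume] F) t) t := fun t =>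
    (hgc.hasDerivAt_convolution_left _ hgs hF.locallyIntegrable t).const_mul _
  refine ⟨lipschitzWith_of_nnnorm_deriv_le (fun t => (hderiv t).differentiableAt) fun t => ?_,
    fun t => ⟨?_, ?_⟩⟩
  · rw [(hderiv t).deriv, ← NNReal.coe_le_coe, coe_nnnorm, Real.norm_eq_abs, abs_mul,
      abs_of_pos (inv_pos.2 hD), NNReal.coe_one, inv_mul_le_one₀ hD]
    have := norm_convolution_le_of_bounded (hgs.continuous_deriv le_rfl) hgc.deriv habs t
    nlinarith [mul_nonneg hI hB0]
  · refine mul_nonneg (inv_pos.2 hD).le (integral_nonneg fun s => ?_)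
    exact mul_nonneg (ρ.nonneg_normed _) (hF0 _)
  · rw [inv_mul_le_one₀ hD]
    have := norm_convolution_le_of_bounded hgs.continuous hgc habs t
    nlinarith [mul_nonneg hJ hB0, le_abs_self ((g ⋆[ContinuousLinearMap.lsmul ℝ ℝ, volume] F) t)]

end Mollify

/-- Mollifying a continuous observable along orbits is jointly continuous in the point and time. -/
lemma continuous_convolution_orbit {X : Type*} [MetricSpace X] [CompactSpace X]
    {φ : ℝ → X → X} (hcont : Continuous fun p : ℝ × X => φ p.1 p.2) {f : X → ℝ}
    (hf : Continuous f) {g : ℝ → ℝ} (hg : Continuous g) (hgc : HasCompactSupport g) :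
    Continuous fun p : X × ℝ =>
      (g ⋆[ContinuousLinearMap.lsmul ℝ ℝ, volume] fun t => f (φ t p.1)) p.2 := by
  obtain ⟨B, hB⟩ := isCompact_univ.exists_bound_of_continuousOn (f := f) hf.continuousOn
  have hj : Continuous fun q : (X × ℝ) × ℝ => g q.2 * f (φ (q.1.2 - q.2) q.1.1) :=
    (hg.comp continuous_snd).mul (hf.comp (hcont.comp
      (f := fun q : (X × ℝ) × ℝ => (q.1.2 - q.2, q.1.1)) (by fun_prop)))
  simp only [convolution_def, ContinuousLinearMap.lsmul_apply, smul_eq_mul]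
  refine continuous_of_dominated (bound := fun s => |g s| * B)
    (fun p => (hj.comp (Continuous.prodMk_right p)).aestronglyMeasurable)
    (fun p => Eventually.of_forall fun s => ?_)
    ((hg.integrable_of_hasCompactSupport hgc).abs.mul_const B)
    (Eventually.of_forall fun s => hj.comp (Continuous.prodMk_left s))
  rw [norm_mul, Real.norm_eq_abs (g s)]
  exact mul_le_mul_of_nonneg_left (hB _ (Set.mem_univ _)) (abs_nonneg _)

/-- for every positive integer `n`, every flow on a compact metric space embeds
equivariantly into the translation on `L(ℝ)^ℕ` so that every coordinate function of every
point of the image is `n`-times continuously differentiable (of class `Cⁿ`). -/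
theorem flow_embeds_in_LR_pow_Cn (X : Type*) [MetricSpace X] [CompactSpace X]
    (φ : ℝ → X → X) (hcont : Continuous fun p : ℝ × X => φ p.1 p.2)
    (h0 : ∀ x : X, φ 0 x = x) (hadd : ∀ (s t : ℝ) (x : X), φ (s + t) x = φ s (φ t x))
    (n : ℕ) (hn : 1 ≤ n) :
    ∃ Φ : X → ℕ → LR,
      Topology.IsEmbedding Φ ∧
      (∀ (x : X) (r : ℝ) (k : ℕ) (t : ℝ),
        ((Φ (φ r x) k : C(ℝ, ℝ)) t) = (Φ x k : C(ℝ, ℝ)) (t + r)) ∧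
      (∀ (x : X) (k : ℕ), ContDiff ℝ n ((Φ x k : C(ℝ, ℝ)) : ℝ → ℝ)) := by
  obtain ⟨f, hf, hf0, hsep⟩ := exists_nonneg_separating_seq X
  have hbound : ∀ k, ∃ B : ℝ, 0 ≤ B ∧ ∀ x, f k x ≤ B := fun k => by
    obtain ⟨B, hB⟩ := isCompact_univ.exists_bound_of_continuousOn (f := f k) (hf k).continuousOn
    exact ⟨max B 0, le_max_right _ _, fun x =>
      ((le_abs_self _).trans (hB x (Set.mem_univ x))).trans (le_max_left _ _)⟩
  choose B hB0 hB using hbound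
  let ρ : ℕ → ContDiffBump (0 : ℝ) := fun m =>
    ⟨1 / ((m : ℝ) + 1), 2 * (1 / ((m : ℝ) + 1)), by positivity,
      by linarith [Nat.one_div_pos_of_nat (α := ℝ) (n := m)]⟩
  have hρ : Tendsto (fun m => (ρ m).rOut) atTop (𝓝 0) := by
    simpa [ρ] using (tendsto_one_div_add_atTop_nhds_zero_nat (𝕜 := ℝ)).const_mul 2
  have hscale := fun k m => exists_scale_mollify (ρ m) (hB0 k)
  choose c hc hcF using hscale
  have horb : ∀ k x, Continuous fun t => f k (φ t x) := fun k x =>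
    (hf k).comp (hcont.comp (Continuous.prodMk_left x))
  let G : ℕ → ℕ → X → ℝ → ℝ := fun k m x =>
    (ρ m).normed volume ⋆[ContinuousLinearMap.lsmul ℝ ℝ, volume] fun t => f k (φ t x)
  have hGsmooth : ∀ k m x, ContDiff ℝ n (G k m x) := fun k m x =>
    (ρ m).hasCompactSupport_normed.contDiff_convolution_left _ (ρ m).contDiff_normed
      (horb k x).locallyIntegrable
  have hGcont : ∀ k m, Continuous fun p : X × ℝ => G k m p.1 p.2 := fun k m =>
    continuous_convolution_orbit hcont (hf k) (ρ m).continuous_normed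
      (ρ m).hasCompactSupport_normed
  have hGlim : ∀ k x, Tendsto (fun m => G k m x 0) atTop (𝓝 (f k x)) := fun k x => by
    have := ContDiffBump.convolution_tendsto_right_of_continuous (μ := volume) hρ (horb k x) 0
    simpa only [h0] using this
  let Ψ : X → ℕ → LR := fun x j =>
    ⟨⟨fun t => c j.unpair.1 j.unpair.2 * G j.unpair.1 j.unpair.2 x t,
        continuous_const.mul (hGsmooth _ _ x).continuous⟩,
      hcF _ _ _ (horb _ x) (fun t => hf0 _ _) (fun t => hB _ _)⟩
  refine ⟨Ψ, ?_, fun x r j t => ?_, fun x j => contDiff_const.mul (hGsmooth _ _ x)⟩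
  · refine (Continuous.isClosedEmbedding ?_ fun x y hxy => ?_).isEmbedding
    · refine continuous_pi fun j => Continuous.subtype_mk
        (ContinuousMap.continuous_of_continuous_uncurry _ ?_) _
      exact continuous_const.mul (hGcont _ _)
    · refine hsep x y fun k => tendsto_nhds_unique (hGlim k x) ?_
      refine (hGlim k y).congr fun m => ?_
      have h := congrArg (fun u : ℕ → LR => (u (Nat.pair k m) : C(ℝ, ℝ)) 0) hxy
      simp only [Ψ, ContinuousMap.coe_mk, Nat.unpair_pair] at h
      exact (mul_left_cancel₀ (hc k m).ne' h).symm
  · change _ * G _ _ _ _ = _ * G _ _ _ _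
    simp only [G, convolution_def, ← hadd]
    simp only [sub_add_eq_add_sub]
end
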